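/- Let f₁, f₂ be convex-quadratic functions on ℝ^d with symmetric positive-definite Hessians H₁, H₂ and optima x₁*, x₂*, and let F = (f₁, f₂). Then the Pareto set of F equals exactly the curve of weighted-sum minimizers: a point x ∈ ℝ^d is Pareto-optimal for F if and only if x = ((1 − t) H₁ + t H₂)⁻¹ ((1 − t) H₁ x₁* + t H₂ x₂*) for some t ∈ [0,1]. -/

import Mathlib

open Matrix

lemma quad_expand {d : ℕ} (H : Matrix (Fin d) (Fin d) ℝ) (hH : H.PosDef) (u v : Fin d → ℝ) :
    (u + v) ⬝ᵥ H.mulVec (u + v) = u ⬝ᵥ H.mulVec u + 2 * (v ⬝ᵥ H.mulVec u) + v ⬝ᵥ H.mulVec v := by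
  have hT : Hᵀ = H := by
    have := hH.isHermitian.eq
    rwa [Matrix.conjTranspose_eq_transpose_of_trivial] at this
  have hs : u ⬝ᵥ H.mulVec v = v ⬝ᵥ H.mulVec u := by
    rw [Matrix.dotProduct_mulVec, ← Matrix.mulVec_transpose, hT, dotProduct_comm]
  rw [Matrix.mulVec_add, add_dotProduct, dotProduct_add, dotProduct_add, hs]
  ring

lemma small_step (A B : ℝ) (hA : A < 0) (hB : 0 ≤ B) :
    ∃ e0 > 0, ∀ e, 0 < e → e ≤ e0 → e * A + (1 / 2) * (e * (e * B)) < 0 := by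
  refine ⟨-A / (B + 1), div_pos (by linarith) (by linarith), fun e he hle => ?_⟩
  rw [le_div_iff₀ (by linarith)] at hle
  have h : A + (1 / 2) * (e * B) < 0 := by nlinarith
  nlinarith [mul_neg_of_pos_of_neg he h]

lemma posDef_comb {d : ℕ} (H₁ H₂ : Matrix (Fin d) (Fin d) ℝ) (hH₁ : H₁.PosDef) (hH₂ : H₂.PosDef)
    (t : ℝ) (ht : t ∈ Set.Icc (0 : ℝ) 1) : ((1 - t) • H₁ + t • H₂).PosDef := by
  obtain ⟨h0, h1⟩ := ht
  rcases h0.eq_or_lt with rfl | h0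
  · simpa using hH₁
  · exact Matrix.PosDef.posSemidef_add (hH₁.posSemidef.smul (by linarith)) (hH₂.smul h0)

lemma curve_iff {d : ℕ} (H₁ H₂ : Matrix (Fin d) (Fin d) ℝ) (hH₁ : H₁.PosDef) (hH₂ : H₂.PosDef)
    (x₁ x₂ x : Fin d → ℝ) (t : ℝ) (ht : t ∈ Set.Icc (0 : ℝ) 1) :
    x = ((1 - t) • H₁ + t • H₂)⁻¹.mulVec ((1 - t) • H₁.mulVec x₁ + t • H₂.mulVec x₂) ↔
      (1 - t) • H₁.mulVec (x - x₁) + t • H₂.mulVec (x - x₂) = 0 := by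
  have hP := posDef_comb H₁ H₂ hH₁ hH₂ t ht
  have hu : IsUnit ((1 - t) • H₁ + t • H₂).det := hP.det_pos.ne'.isUnit
  have key : (1 - t) • H₁.mulVec (x - x₁) + t • H₂.mulVec (x - x₂) =
      ((1 - t) • H₁ + t • H₂).mulVec x - ((1 - t) • H₁.mulVec x₁ + t • H₂.mulVec x₂) := by
    rw [Matrix.mulVec_sub, Matrix.mulVec_sub, Matrix.add_mulVec, Matrix.smul_mulVec,
      Matrix.smul_mulVec, smul_sub, smul_sub]
    abel
  rw [key, sub_eq_zero]
  constructor
  · intro h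
    conv_lhs => rw [h]
    rw [Matrix.mulVec_mulVec, Matrix.mul_nonsing_inv _ hu, Matrix.one_mulVec]
  · intro h
    rw [← h, Matrix.mulVec_mulVec, Matrix.nonsing_inv_mul _ hu, Matrix.one_mulVec]

lemma descent {d : ℕ} (g₁ g₂ : Fin d → ℝ)
    (h : ∀ t ∈ Set.Icc (0 : ℝ) 1, (1 - t) • g₁ + t • g₂ ≠ 0) :
    ∃ v : Fin d → ℝ, v ⬝ᵥ g₁ < 0 ∧ v ⬝ᵥ g₂ < 0 := by
  have hpos : ∀ g : Fin d → ℝ, g ≠ 0 → 0 < g ⬝ᵥ g := fun g hg =>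
    lt_of_le_of_ne (by simpa using dotProduct_star_self_nonneg g)
      (fun h => hg (dotProduct_self_eq_zero.1 h.symm))
  have hg₁ : g₁ ≠ 0 := by simpa using h 0 (by simp)
  have hg₂ : g₂ ≠ 0 := by simpa using h 1 (by simp)
  obtain ⟨p, hp, hpp⟩ : ∃ p : ℝ, 0 < p ∧ g₁ ⬝ᵥ g₁ = p * p :=
    ⟨_, Real.sqrt_pos.2 (hpos _ hg₁), (Real.mul_self_sqrt (hpos _ hg₁).le).symm⟩
  obtain ⟨q, hq, hqq⟩ : ∃ p : ℝ, 0 < p ∧ g₂ ⬝ᵥ g₂ = p * p :=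
    ⟨_, Real.sqrt_pos.2 (hpos _ hg₂), (Real.mul_self_sqrt (hpos _ hg₂).le).symm⟩
  have hw : q • g₁ + p • g₂ ≠ 0 := by
    intro hw
    apply h (p / (p + q)) ⟨by positivity, by rw [div_le_one (by positivity)]; linarith⟩
    have h1 : 1 - p / (p + q) = (p + q)⁻¹ * q := by field_simp; ring
    have h2 : p / (p + q) = (p + q)⁻¹ * p := by field_simp
    rw [h1, h2, mul_smul, mul_smul, ← smul_add, hw, smul_zero]
  have hww := hpos _ hw
  have hc : g₂ ⬝ᵥ g₁ = g₁ ⬝ᵥ g₂ := dotProduct_comm _ _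
  simp only [add_dotProduct, dotProduct_add, smul_dotProduct, dotProduct_smul, smul_eq_mul,
    hpp, hqq, hc] at hww
  have hb : 0 < p * q + g₁ ⬝ᵥ g₂ := by
    have : 0 < (2 * p * q) * (p * q + g₁ ⬝ᵥ g₂) := by linarith
    exact (mul_pos_iff_of_pos_left (by positivity)).1 this
  refine ⟨-(q • g₁ + p • g₂), ?_, ?_⟩
  · simp only [neg_dotProduct, add_dotProduct, smul_dotProduct, smul_eq_mul, hpp, hc]
    nlinarith [mul_pos hp hb]
  · simp only [neg_dotProduct, add_dotProduct, smul_dotProduct, smul_eq_mul, hqq]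
    nlinarith [mul_pos hq hb]

/-- For convex-quadratic objectives `f₁, f₂` with symmetric positive-definite
Hessians, the Pareto set of `F = (f₁, f₂)` is exactly the curve of weighted-sum minimizers:
`x` is Pareto-optimal iff `x = ((1−t)H₁ + tH₂)⁻¹((1−t)H₁x₁* + tH₂x₂*)` for some `t ∈ [0,1]`. -/
theorem pareto_set_eq_weighted_sum_curve {d : ℕ}
    (H₁ H₂ : Matrix (Fin d) (Fin d) ℝ) (hH₁ : H₁.PosDef) (hH₂ : H₂.PosDef)
    (x₁ x₂ : Fin d → ℝ) (y₁ y₂ : ℝ)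
    (f₁ f₂ : (Fin d → ℝ) → ℝ)
    (hf₁ : ∀ x, f₁ x = (1 / 2) * ((x - x₁) ⬝ᵥ H₁.mulVec (x - x₁)) + y₁)
    (hf₂ : ∀ x, f₂ x = (1 / 2) * ((x - x₂) ⬝ᵥ H₂.mulVec (x - x₂)) + y₂)
    (x : Fin d → ℝ) :
    (¬ ∃ x' : Fin d → ℝ,
        f₁ x' ≤ f₁ x ∧ f₂ x' ≤ f₂ x ∧ (f₁ x' < f₁ x ∨ f₂ x' < f₂ x)) ↔
      ∃ t ∈ Set.Icc (0 : ℝ) 1,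
        x = ((1 - t) • H₁ + t • H₂)⁻¹.mulVec
          ((1 - t) • H₁.mulVec x₁ + t • H₂.mulVec x₂) := by
  have exp₁ : ∀ v, f₁ (x + v) = f₁ x + v ⬝ᵥ H₁.mulVec (x - x₁) + (1 / 2) * (v ⬝ᵥ H₁.mulVec v) := by
    intro v
    rw [hf₁, hf₁, add_sub_right_comm, quad_expand H₁ hH₁]
    ring
  have exp₂ : ∀ v, f₂ (x + v) = f₂ x + v ⬝ᵥ H₂.mulVec (x - x₂) + (1 / 2) * (v ⬝ᵥ H₂.mulVec v) := by
    intro v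
    rw [hf₂, hf₂, add_sub_right_comm, quad_expand H₂ hH₂]
    ring
  constructor
  · intro hx
    by_contra hcon
    obtain ⟨v, hv₁, hv₂⟩ := descent (H₁.mulVec (x - x₁)) (H₂.mulVec (x - x₂))
      (fun t ht h => hcon ⟨t, ht, (curve_iff H₁ H₂ hH₁ hH₂ x₁ x₂ x t ht).2 h⟩)
    have hB₁ : 0 ≤ v ⬝ᵥ H₁.mulVec v := by simpa using hH₁.posSemidef.dotProduct_mulVec_nonneg v
    have hB₂ : 0 ≤ v ⬝ᵥ H₂.mulVec v := by simpa using hH₂.posSemidef.dotProduct_mulVec_nonneg v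
    obtain ⟨a, ha, ha'⟩ := small_step _ _ hv₁ hB₁
    obtain ⟨b, hb, hb'⟩ := small_step _ _ hv₂ hB₂
    have k₁ := ha' (min a b) (lt_min ha hb) (min_le_left _ _)
    have k₂ := hb' (min a b) (lt_min ha hb) (min_le_right _ _)
    have e₁ := exp₁ (min a b • v)
    have e₂ := exp₂ (min a b • v)
    simp only [Matrix.mulVec_smul, smul_dotProduct, dotProduct_smul, smul_eq_mul] at e₁ e₂
    exact hx ⟨x + min a b • v, by linarith, by linarith, Or.inl (by linarith)⟩
  · rintro ⟨t, ht, hx⟩ ⟨x', hle₁, hle₂, hlt⟩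
    rw [curve_iff H₁ H₂ hH₁ hH₂ x₁ x₂ x t ht] at hx
    obtain ⟨v, rfl⟩ : ∃ v, x' = x + v := ⟨x' - x, by abel⟩
    have hv : v ≠ 0 := by
      rintro rfl
      simp at hlt
    have hP : 0 < v ⬝ᵥ ((1 - t) • H₁ + t • H₂).mulVec v := by
      simpa using (posDef_comb H₁ H₂ hH₁ hH₂ t ht).dotProduct_mulVec_pos hv
    have hg := congrArg (fun w => v ⬝ᵥ w) hx
    simp only [Matrix.add_mulVec, Matrix.smul_mulVec, dotProduct_add, dotProduct_smul,
      smul_eq_mul, dotProduct_zero] at hP hg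
    rw [exp₁] at hle₁
    rw [exp₂] at hle₂
    have m₁ := mul_le_mul_of_nonneg_left hle₁ (sub_nonneg.2 ht.2)
    have m₂ := mul_le_mul_of_nonneg_left hle₂ ht.1
    linarith
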